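/- Fix θ ∈ (0,1), q = Θ(n^{2(θ−1)}), and any constant ν > 0; let G ~ ER(n,q) with k̄ = q·C(n,2), and perform t i.i.d. Bernoulli(p) tests with p = √(2ν/(q n²)). If for some η > 0 one has t ≤ (1−η)·2θ·e·k̄·ln n for all n, then the SSS decoder fails with probability tending to 1; more precisely, with probability → 1 there exists a satisfying edge set of cardinality strictly smaller than |E(G)|, so that any minimum-cardinality satisfying set differs from E(G). -/

import Mathlib

open scoped BigOperators Classical
open Finset Filter

noncomputable section

/-- The set of all potential edges: unordered pairs of distinct nodes of `Fin n`. -/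
def allPairs (n : ℕ) : Finset (Sym2 (Fin n)) :=
  Finset.univ.filter fun e => ¬ e.IsDiag

/-- Both endpoints of the pair `e` lie in the test `L`. -/
def pairIn {n : ℕ} (e : Sym2 (Fin n)) (L : Finset (Fin n)) : Prop :=
  ∀ v ∈ e, v ∈ L

/-- The test `L` covers some edge of the edge set `E` (positive outcome `Y = 1`). -/
def covers {n : ℕ} (E : Finset (Sym2 (Fin n))) (L : Finset (Fin n)) : Prop :=
  ∃ e ∈ E, pairIn e L

/-- ER(n,q) probability weight of a given edge set `E`. -/
def erWeight (n : ℕ) (q : ℝ) (E : Finset (Sym2 (Fin n))) : ℝ :=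
  q ^ E.card * (1 - q) ^ ((allPairs n).card - E.card)

/-- Probability of an event under the Erdős–Rényi random graph ER(n,q). -/
def erProb (n : ℕ) (q : ℝ) (A : Finset (Sym2 (Fin n)) → Prop) : ℝ :=
  ∑ E ∈ (allPairs n).powerset, if A E then erWeight n q E else 0

/-- Bernoulli(p) probability weight of a single test `L ⊆ {1,…,n}`. -/
def testWeight (n : ℕ) (p : ℝ) (L : Finset (Fin n)) : ℝ :=
  p ^ L.card * (1 - p) ^ (n - L.card)

/-- Probability of an event for a single Bernoulli(p) test. -/
def bernProb (n : ℕ) (p : ℝ) (A : Finset (Fin n) → Prop) : ℝ :=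
  ∑ L : Finset (Fin n), if A L then testWeight n p L else 0

/-- Probability weight of `t` i.i.d. Bernoulli(p) tests. -/
def testsWeight (n t : ℕ) (p : ℝ) (Ls : Fin t → Finset (Fin n)) : ℝ :=
  ∏ i, testWeight n p (Ls i)

/-- Probability of an event for `t` i.i.d. Bernoulli(p) tests. -/
def bernTestsProb (n t : ℕ) (p : ℝ) (A : (Fin t → Finset (Fin n)) → Prop) : ℝ :=
  ∑ Ls : Fin t → Finset (Fin n), if A Ls then testsWeight n t p Ls else 0

/-- Joint probability over an ER(n,q) graph and `t` i.i.d. Bernoulli(p) tests. -/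
def erTestsProb (n t : ℕ) (q p : ℝ)
    (A : Finset (Sym2 (Fin n)) → (Fin t → Finset (Fin n)) → Prop) : ℝ :=
  ∑ E ∈ (allPairs n).powerset, ∑ Ls : Fin t → Finset (Fin n),
    if A E Ls then erWeight n q E * testsWeight n t p Ls else 0

/-- Degree of node `v` in the edge set `E`. -/
def degOf {n : ℕ} (E : Finset (Sym2 (Fin n))) (v : Fin n) : ℕ :=
  (E.filter fun e => v ∈ e).card

/-- Maximum degree of the edge set `E`. -/
def maxDeg {n : ℕ} (E : Finset (Sym2 (Fin n))) : ℕ :=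
  Finset.univ.sup (degOf E)

/-- Average number of edges of ER(n, q n): `k̄ = q·C(n,2)`. -/
def kbar (q : ℕ → ℝ) (n : ℕ) : ℝ := q n * (n.choose 2 : ℝ)

/-- Two pairs are vertex-disjoint. -/
def sym2Disjoint {n : ℕ} (e e' : Sym2 (Fin n)) : Prop := ∀ v, v ∈ e → v ∉ e'

/-- Expectation of `f` under the random subset of `S` that contains each element independently
with probability `r`. -/
def bexp {α : Type*} (r : ℝ) (S : Finset α) (f : Finset α → ℝ) : ℝ :=
  ∑ E ∈ S.powerset, r ^ E.card * (1 - r) ^ (S.card - E.card) * f E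

section bexp
variable {α : Type*} {r : ℝ} {S : Finset α} {f g : Finset α → ℝ}

lemma bexp_empty : bexp r ∅ f = f ∅ := by simp [bexp]

lemma bexp_insert [DecidableEq α] {a : α} (ha : a ∉ S) :
    bexp r (insert a S) f = r * bexp r S (fun E => f (insert a E)) + (1 - r) * bexp r S f := by
  unfold bexp
  rw [Finset.sum_powerset_insert ha, add_comm, Finset.mul_sum, Finset.mul_sum]
  congr 1
  · refine Finset.sum_congr rfl fun E hE => ?_
    have h : a ∉ E := fun h => ha (Finset.mem_powerset.1 hE h)
    rw [Finset.card_insert_of_notMem h, Finset.card_insert_of_notMem ha, Nat.add_sub_add_right]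
    ring
  · refine Finset.sum_congr rfl fun E hE => ?_
    have h := Finset.card_le_card (Finset.mem_powerset.1 hE)
    rw [Finset.card_insert_of_notMem ha, Nat.succ_sub h, pow_succ]
    ring

lemma bexp_add : bexp r S (fun E => f E + g E) = bexp r S f + bexp r S g := by
  simp only [bexp, mul_add, Finset.sum_add_distrib]

lemma bexp_const_mul (c : ℝ) : bexp r S (fun E => c * f E) = c * bexp r S f := by
  simp only [bexp, Finset.mul_sum]
  exact Finset.sum_congr rfl fun E _ => by ring

lemma bexp_const (c : ℝ) : bexp r S (fun _ => c) = c := by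
  induction S using Finset.induction_on with
  | empty => exact bexp_empty
  | insert a S ha ih => rw [bexp_insert ha, ih]; ring

lemma bexp_mono (h0 : 0 ≤ r) (h1 : r ≤ 1) (h : ∀ E ⊆ S, f E ≤ g E) :
    bexp r S f ≤ bexp r S g := by
  refine Finset.sum_le_sum fun E hE => mul_le_mul_of_nonneg_left (h E (Finset.mem_powerset.1 hE)) ?_
  have := sub_nonneg.2 h1
  positivity

lemma bexp_sum {ι : Type*} (s : Finset ι) (F : ι → Finset α → ℝ) :
    bexp r S (fun E => ∑ i ∈ s, F i E) = ∑ i ∈ s, bexp r S (F i) := by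
  simp only [bexp, Finset.mul_sum]
  exact Finset.sum_comm

lemma bexp_card : bexp r S (fun E => (E.card : ℝ)) = r * S.card := by
  induction S using Finset.induction_on with
  | empty => simp [bexp_empty]
  | insert a S ha ih =>
    have h : bexp r S (fun E => ((insert a E).card : ℝ)) = bexp r S (fun E => (E.card : ℝ) + 1) :=
      Finset.sum_congr rfl fun E hE => by
        beta_reduce
        rw [Finset.card_insert_of_notMem fun h => ha (Finset.mem_powerset.1 hE h)]
        push_cast; ring
    rw [bexp_insert ha, h, bexp_add, bexp_const, ih, Finset.card_insert_of_notMem ha]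
    push_cast; ring

/-- The probability that a random subset contains `T` is `r ^ |T|`. -/
lemma bexp_superset [DecidableEq α] {T : Finset α} (hT : T ⊆ S) :
    bexp r S (fun E => if T ⊆ E then 1 else 0) = r ^ T.card := by
  induction S using Finset.induction_on generalizing T with
  | empty => simp [bexp_empty, Finset.subset_empty.1 hT]
  | insert a S ha ih =>
    rw [bexp_insert ha]
    by_cases haT : a ∈ T
    · have h1 : bexp r S (fun E => if T ⊆ insert a E then (1 : ℝ) else 0) = r ^ (T.erase a).card := by
        rw [← ih (T := T.erase a) (by rwa [← Finset.subset_insert_iff])]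
        simp only [Finset.subset_insert_iff]
      have h2 : bexp r S (fun E => if T ⊆ E then (1 : ℝ) else 0) = 0 := by
        refine Finset.sum_eq_zero fun E hE => ?_
        have h : ¬ T ⊆ E := fun h => ha (Finset.mem_powerset.1 hE (h haT))
        simp only [if_neg h, mul_zero]
      rw [h1, h2, mul_zero, add_zero, ← pow_succ', Finset.card_erase_add_one haT]
    · have h1 : bexp r S (fun E => if T ⊆ insert a E then (1 : ℝ) else 0) =
          bexp r S (fun E => if T ⊆ E then (1 : ℝ) else 0) := by
        simp only [Finset.subset_insert_iff_of_notMem haT]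
      rw [h1, ih ((Finset.subset_insert_iff_of_notMem haT).1 hT)]
      ring

/-- Efron–Stein inequality for functions with differences bounded by `c`. -/
lemma bexp_sq_sub_le [DecidableEq α] (h0 : 0 ≤ r) (h1 : r ≤ 1) (c : ℝ)
    (hf : ∀ E, ∀ a ∈ S, a ∉ E → |f (insert a E) - f E| ≤ c) :
    bexp r S (fun E => (f E - bexp r S f) ^ 2) ≤ S.card * (r * c ^ 2) := by
  have key : bexp r S (fun E => f E ^ 2) ≤ bexp r S f ^ 2 + S.card * (r * c ^ 2) := by
    induction S using Finset.induction_on generalizing f with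
    | empty => simp [bexp_empty]
    | insert a S ha ih =>
      set F : Finset α → ℝ := fun E => r * f (insert a E) + (1 - r) * f E with hF
      have hFf : bexp r (insert a S) f = bexp r S F := by
        rw [bexp_insert ha, hF, bexp_add, bexp_const_mul, bexp_const_mul]
      have hF' : ∀ E, ∀ b ∈ S, b ∉ E → |F (insert b E) - F E| ≤ c := by
        intro E b hb hbE
        have hba : b ≠ a := fun h => ha (h ▸ hb)
        have e1 := abs_le.1 (hf (insert a E) b (Finset.mem_insert_of_mem hb) (by simp [hba, hbE]))
        have e2 := abs_le.1 (hf E b (Finset.mem_insert_of_mem hb) hbE)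
        simp only [hF]
        rw [Finset.insert_comm a b E, abs_le]
        constructor <;> nlinarith
      have hsq : bexp r (insert a S) (fun E => f E ^ 2) ≤
          bexp r S (fun E => F E ^ 2 + r * c ^ 2) := by
        rw [bexp_insert ha, ← bexp_const_mul, ← bexp_const_mul, ← bexp_add]
        refine bexp_mono h0 h1 fun E hE => ?_
        have e := hf E a (Finset.mem_insert_self a S) fun h => ha (hE h)
        have e2 : (f (insert a E) - f E) ^ 2 ≤ c ^ 2 := sq_le_sq' (abs_le.1 e).1 (abs_le.1 e).2
        have e3 : r * (1 - r) * (f (insert a E) - f E) ^ 2 ≤ r * c ^ 2 := by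
          refine mul_le_mul ?_ e2 (sq_nonneg _) h0
          nlinarith
        simp only [hF]
        nlinarith
      rw [bexp_add, bexp_const] at hsq
      have := ih hF'
      rw [hFf, Finset.card_insert_of_notMem ha]
      push_cast
      linarith
  set m := bexp r S f with hm
  have : bexp r S (fun E => (f E - m) ^ 2) = bexp r S (fun E => f E ^ 2 + ((-2 * m) * f E + m ^ 2)) := by
    congr 1; ext E; ring
  rw [this, bexp_add, bexp_add, bexp_const_mul, bexp_const, ← hm]
  linarith

lemma bexp_filter_card_eq_zero (A : α → Prop) [DecidablePred A] :
    bexp r S (fun E => if (E.filter A).card = 0 then 1 else 0) = (1 - r) ^ (S.filter A).card := by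
  induction S using Finset.induction_on with
  | empty => simp [bexp_empty]
  | insert a S ha ih =>
    rw [bexp_insert ha, ih]
    by_cases hA : A a
    · have : bexp r S (fun E => if ((insert a E).filter A).card = 0 then (1 : ℝ) else 0) = 0 := by
        simp [Finset.filter_insert, hA, bexp]
      rw [this, Finset.filter_insert, if_pos hA, Finset.card_insert_of_notMem (by simp [ha])]
      ring
    · have : bexp r S (fun E => if ((insert a E).filter A).card = 0 then (1 : ℝ) else 0) =
          (1 - r) ^ (S.filter A).card := by
        simp only [Finset.filter_insert, if_neg hA, ih]
      rw [this, Finset.filter_insert, if_neg hA]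
      ring

lemma bexp_filter_card_eq_one (A : α → Prop) [DecidablePred A] :
    (1 - r) * bexp r S (fun E => if (E.filter A).card = 1 then 1 else 0) =
      (S.filter A).card * r * (1 - r) ^ (S.filter A).card := by
  induction S using Finset.induction_on with
  | empty => simp [bexp_empty]
  | insert a S ha ih =>
    rw [bexp_insert ha]
    by_cases hA : A a
    · have : bexp r S (fun E => if ((insert a E).filter A).card = 1 then (1 : ℝ) else 0) =
          (1 - r) ^ (S.filter A).card := by
        rw [← bexp_filter_card_eq_zero A]
        refine Finset.sum_congr rfl fun E hE => ?_
        have haE : a ∉ E.filter A := fun h =>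
          ha (Finset.mem_powerset.1 hE (Finset.mem_filter.1 h).1)
        simp only [Finset.filter_insert, if_pos hA, Finset.card_insert_of_notMem haE,
          Nat.add_eq_right]
      rw [this, mul_add, mul_left_comm (1 - r) (1 - r), ih, Finset.filter_insert, if_pos hA,
        Finset.card_insert_of_notMem (by simp [ha])]
      push_cast
      ring
    · have : bexp r S (fun E => if ((insert a E).filter A).card = 1 then (1 : ℝ) else 0) =
          bexp r S (fun E => if (E.filter A).card = 1 then (1 : ℝ) else 0) := by
        simp only [Finset.filter_insert, if_neg hA]
      rw [this, Finset.filter_insert, if_neg hA, ← ih]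
      ring

/-- A binomial variable equals `1` with probability at most about `1 / e`. -/
lemma bexp_filter_card_eq_one_le (h1 : r < 1) (A : α → Prop) [DecidablePred A] :
    bexp r S (fun E => if (E.filter A).card = 1 then 1 else 0) ≤ Real.exp (-1) / (1 - r) := by
  rw [le_div_iff₀ (sub_pos.2 h1), mul_comm, bexp_filter_card_eq_one]
  set N := (S.filter A).card
  have e1 : (1 - r) ^ N ≤ Real.exp (-(N * r)) := by
    rw [show -(N * r) = N * (-r) by ring, Real.exp_nat_mul]
    have := Real.add_one_le_exp (-r)
    exact pow_le_pow_left₀ (by linarith) (by linarith) _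
  have e2 : N * r ≤ Real.exp (N * r - 1) := by
    have := Real.add_one_le_exp (N * r - 1)
    linarith
  calc N * r * (1 - r) ^ N ≤ Real.exp (N * r - 1) * Real.exp (-(N * r)) :=
        mul_le_mul e2 e1 (pow_nonneg (sub_pos.2 h1).le _) (Real.exp_nonneg _)
    _ = Real.exp (-1) := by rw [← Real.exp_add]; congr 1; ring

end bexp

/-- Second moment bound: if the events `rev e`, `e ∈ E`, are mutually exclusive, then `t` independent
trials hit all of them with probability at most the inverse of the expected number of events
that are never hit. -/
lemma prob_all_hit_le {Ω ι : Type*} [Fintype Ω] (w : Ω → ℝ) (hw : ∀ ω, 0 ≤ w ω)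
    (hw1 : ∑ ω, w ω = 1) (E : Finset ι) (t : ℕ) (rev : ι → Ω → Prop)
    (hrev : ∀ ω, ∀ e ∈ E, ∀ e' ∈ E, rev e ω → rev e' ω → e = e')
    (hμ : 0 < ∑ e ∈ E, (1 - ∑ ω, w ω * if rev e ω then 1 else 0) ^ t) :
    (∑ ωs : Fin t → Ω, if ∀ e ∈ E, ∃ i, rev e (ωs i) then ∏ i, w (ωs i) else 0) ≤
      1 / ∑ e ∈ E, (1 - ∑ ω, w ω * if rev e ω then 1 else 0) ^ t := by
  set ρ : ι → Ω → ℝ := fun e ω => if rev e ω then 1 else 0 with hρ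
  set μ := ∑ e ∈ E, (1 - ∑ ω, w ω * if rev e ω then 1 else 0) ^ t with hμd
  set m : ι → (Fin t → Ω) → ℝ := fun e ωs => ∏ i, (1 - ρ e (ωs i)) with hm
  set W : (Fin t → Ω) → ℝ := fun ωs => ∏ i, w (ωs i) with hW
  have hρ01 : ∀ e ω, 0 ≤ 1 - ρ e ω := fun e ω => by
    simp only [hρ]; split_ifs <;> norm_num
  have hmean : ∀ e, ∑ ωs, W ωs * m e ωs = (1 - ∑ ω, w ω * ρ e ω) ^ t := fun e => by
    simp only [hW, hm, ← Finset.prod_mul_distrib]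
    rw [← Fintype.sum_pow (fun ω => w ω * (1 - ρ e ω))]
    simp only [mul_sub, mul_one, Finset.sum_sub_distrib, hw1]
  have hW1 : ∑ ωs, W ωs = 1 := by
    simp only [hW]; rw [← Fintype.sum_pow w, hw1, one_pow]
  have hnn : ∀ e, 0 ≤ 1 - ∑ ω, w ω * ρ e ω := fun e => by
    have : 1 - ∑ ω, w ω * ρ e ω = ∑ ω, w ω * (1 - ρ e ω) := by
      simp only [mul_sub, mul_one, Finset.sum_sub_distrib, hw1]
    rw [this]
    exact Finset.sum_nonneg fun ω _ => mul_nonneg (hw ω) (hρ01 e ω)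
  have hpair : ∀ e ∈ E, ∀ e' ∈ E, ∑ ωs, W ωs * (m e ωs * m e' ωs) ≤
      (1 - ∑ ω, w ω * ρ e ω) ^ t * (1 - ∑ ω, w ω * ρ e' ω) ^ t +
        if e = e' then (1 - ∑ ω, w ω * ρ e ω) ^ t else 0 := by
    intro e he e' he'
    split_ifs with h
    · subst h
      have : ∀ ωs, m e ωs * m e ωs = m e ωs := fun ωs => by
        simp only [hm, ← Finset.prod_mul_distrib]
        refine Finset.prod_congr rfl fun i _ => ?_
        simp only [hρ]; split_ifs <;> norm_num
      simp only [this, hmean]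
      have := pow_nonneg (hnn e) t
      nlinarith
    · have hstep : ∑ ωs, W ωs * (m e ωs * m e' ωs) =
          (1 - ∑ ω, w ω * ρ e ω - ∑ ω, w ω * ρ e' ω) ^ t := by
        simp only [hW, hm, ← Finset.prod_mul_distrib]
        rw [← Fintype.sum_pow (fun ω => w ω * ((1 - ρ e ω) * (1 - ρ e' ω)))]
        congr 1
        nth_rewrite 3 [← hw1]
        rw [← Finset.sum_sub_distrib, ← Finset.sum_sub_distrib]
        refine Finset.sum_congr rfl fun ω _ => ?_
        have : ρ e ω * ρ e' ω = 0 := by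
          simp only [hρ]
          split_ifs with h1 h2 <;> norm_num
          exact h (hrev ω e he e' he' h1 h2)
        linear_combination w ω * this
      have h0 : 0 ≤ 1 - ∑ ω, w ω * ρ e ω - ∑ ω, w ω * ρ e' ω := by
        rw [← hw1, ← Finset.sum_sub_distrib, ← Finset.sum_sub_distrib]
        refine Finset.sum_nonneg fun ω _ => ?_
        have : ρ e ω + ρ e' ω ≤ 1 := by
          simp only [hρ]
          split_ifs with h1 h2 <;> norm_num
          exact h (hrev ω e he e' he' h1 h2)
        nlinarith [hw ω]
      rw [hstep, add_zero, ← mul_pow]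
      refine pow_le_pow_left₀ h0 ?_ t
      have hr : ∀ e, 0 ≤ ∑ ω, w ω * ρ e ω := fun e => Finset.sum_nonneg fun ω _ =>
        mul_nonneg (hw ω) (by simp only [hρ]; split_ifs <;> norm_num)
      nlinarith [mul_nonneg (hr e) (hr e')]
  have hX1 : ∑ ωs, W ωs * ∑ e ∈ E, m e ωs = μ := by
    simp only [Finset.mul_sum]
    rw [Finset.sum_comm]
    exact Finset.sum_congr rfl fun e _ => hmean e
  have hX2 : ∑ ωs, W ωs * (∑ e ∈ E, m e ωs) ^ 2 ≤ μ ^ 2 + μ := by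
    have e1 : ∑ ωs, W ωs * (∑ e ∈ E, m e ωs) ^ 2 =
        ∑ e ∈ E, ∑ e' ∈ E, ∑ ωs, W ωs * (m e ωs * m e' ωs) := by
      simp only [sq, Finset.sum_mul_sum]
      simp only [Finset.mul_sum]
      rw [Finset.sum_comm]
      exact Finset.sum_congr rfl fun e _ => Finset.sum_comm
    rw [e1]
    refine (Finset.sum_le_sum fun e he => Finset.sum_le_sum fun e' he' => hpair e he e' he').trans ?_
    simp only [Finset.sum_add_distrib, ← Finset.sum_mul_sum]
    rw [sq]
    refine add_le_add le_rfl (le_of_eq ?_)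
    refine Finset.sum_congr rfl fun e he => ?_
    rw [Finset.sum_ite_eq, if_pos he]
  have hchev : ∀ ωs, (if ∀ e ∈ E, ∃ i, rev e (ωs i) then ∏ i, w (ωs i) else 0) ≤
      W ωs * ((∑ e ∈ E, m e ωs - μ) ^ 2 / μ ^ 2) := by
    intro ωs
    have hWnn : 0 ≤ W ωs := Finset.prod_nonneg fun i _ => hw _
    split_ifs with h
    · have : ∑ e ∈ E, m e ωs = 0 := Finset.sum_eq_zero fun e he => by
        obtain ⟨i, hi⟩ := h e he
        exact Finset.prod_eq_zero (Finset.mem_univ i) (by simp [hρ, hi])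
      rw [this, zero_sub, neg_sq, div_self (by positivity), mul_one]
    · positivity
  refine (Finset.sum_le_sum fun ωs _ => hchev ωs).trans ?_
  clear_value μ
  have : ∑ ωs, W ωs * ((∑ e ∈ E, m e ωs - μ) ^ 2 / μ ^ 2) =
      (∑ ωs, W ωs * (∑ e ∈ E, m e ωs) ^ 2 - 2 * μ * (∑ ωs, W ωs * ∑ e ∈ E, m e ωs)
        + μ ^ 2 * ∑ ωs, W ωs) / μ ^ 2 := by
    rw [Finset.mul_sum Finset.univ _ (2 * μ), Finset.mul_sum, ← Finset.sum_sub_distrib, ← Finset.sum_add_distrib,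
      Finset.sum_div]
    exact Finset.sum_congr rfl fun ωs _ => by ring
  rw [this, hX1, hW1, div_le_div_iff₀ (by positivity) hμ]
  nlinarith

/-- The test `L` contains the pair `e` and no other pair of `E`. -/
def revealed {n : ℕ} (E : Finset (Sym2 (Fin n))) (e : Sym2 (Fin n)) (L : Finset (Fin n)) : Prop :=
  pairIn e L ∧ ∀ e' ∈ E, pairIn e' L → e' = e

/-- Probability that a Bernoulli(p) test contains exactly one pair of `E`. -/
def singleProb (n : ℕ) (p : ℝ) (E : Finset (Sym2 (Fin n))) : ℝ :=
  ∑ L, testWeight n p L * if (E.filter fun e => pairIn e L).card = 1 then 1 else 0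

/-- Some edge set that explains all outcomes is strictly smaller than `E`. -/
def smallerExists (n t : ℕ) (E : Finset (Sym2 (Fin n))) (Ls : Fin t → Finset (Fin n)) : Prop :=
  ∃ F : Finset (Sym2 (Fin n)), F ⊆ allPairs n ∧
    (∀ i, covers F (Ls i) ↔ covers E (Ls i)) ∧ F.card < E.card

lemma card_allPairs (n : ℕ) : (allPairs n).card = n.choose 2 := by
  have h := Sym2.card_subtype_not_diag (α := Fin n)
  rw [Fintype.card_fin, Fintype.card_subtype] at h
  rw [← h, allPairs]

lemma sum_testWeight_mul (n : ℕ) (p : ℝ) (f : Finset (Fin n) → ℝ) :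
    ∑ L, testWeight n p L * f L = bexp p Finset.univ f := by
  simp [bexp, testWeight]

lemma sum_testWeight (n : ℕ) (p : ℝ) : ∑ L, testWeight n p L = 1 := by
  simpa [bexp_const] using sum_testWeight_mul n p fun _ => 1

lemma testWeight_nonneg {n : ℕ} {p : ℝ} (h0 : 0 ≤ p) (h1 : p ≤ 1) (L : Finset (Fin n)) :
    0 ≤ testWeight n p L :=
  mul_nonneg (pow_nonneg h0 _) (pow_nonneg (sub_nonneg.2 h1) _)

lemma sum_testWeight_pairIn {n : ℕ} (p : ℝ) {e : Sym2 (Fin n)} (he : e ∈ allPairs n) :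
    (∑ L, testWeight n p L * if pairIn e L then 1 else 0) = p ^ 2 := by
  induction e using Sym2.ind with
  | _ u v =>
    have huv : u ≠ v := by simpa [allPairs] using he
    rw [sum_testWeight_mul, ← Finset.card_pair huv,
      ← bexp_superset (r := p) (Finset.subset_univ ({u, v} : Finset (Fin n)))]
    congr 1
    ext L
    have : pairIn s(u, v) L ↔ {u, v} ⊆ L := by
      simp [pairIn, Finset.insert_subset_iff]
    simp only [this]

lemma singleProb_insert_sub_le {n : ℕ} {p : ℝ} (h0 : 0 ≤ p) (h1 : p ≤ 1)
    (E : Finset (Sym2 (Fin n))) {a : Sym2 (Fin n)} (ha : a ∈ allPairs n) :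
    |singleProb n p (insert a E) - singleProb n p E| ≤ p ^ 2 := by
  rw [← sum_testWeight_pairIn p ha, singleProb, singleProb, ← Finset.sum_sub_distrib]
  refine (Finset.abs_sum_le_sum_abs _ _).trans (Finset.sum_le_sum fun L _ => ?_)
  rw [← mul_sub, abs_mul, abs_of_nonneg (testWeight_nonneg h0 h1 L)]
  refine mul_le_mul_of_nonneg_left ?_ (testWeight_nonneg h0 h1 L)
  by_cases h : pairIn a L
  · rw [if_pos h]
    split_ifs <;> norm_num
  · rw [Finset.filter_insert, if_neg h, sub_self, abs_zero, if_neg h]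

lemma bexp_singleProb_le {n : ℕ} {p q : ℝ} (h0 : 0 ≤ p) (h1 : p ≤ 1) (hq : q < 1) :
    bexp q (allPairs n) (singleProb n p) ≤ Real.exp (-1) / (1 - q) := by
  have : bexp q (allPairs n) (singleProb n p) = ∑ L, testWeight n p L *
      bexp q (allPairs n) (fun E => if (E.filter fun e => pairIn e L).card = 1 then 1 else 0) := by
    unfold singleProb
    rw [bexp_sum]
    simp only [bexp_const_mul]
  rw [this]
  calc _ ≤ ∑ L, testWeight n p L * (Real.exp (-1) / (1 - q)) :=
        Finset.sum_le_sum fun L _ => mul_le_mul_of_nonneg_left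
          (bexp_filter_card_eq_one_le hq _) (testWeight_nonneg h0 h1 L)
    _ = _ := by rw [← Finset.sum_mul, sum_testWeight, one_mul]

lemma sum_revealed_le {n : ℕ} (E : Finset (Sym2 (Fin n))) (L : Finset (Fin n)) :
    (∑ e ∈ E, if revealed E e L then (1 : ℝ) else 0) ≤
      if (E.filter fun e => pairIn e L).card = 1 then 1 else 0 := by
  rw [Finset.sum_boole]
  by_cases h : ∃ e ∈ E, revealed E e L
  · obtain ⟨e, he, h1, h2⟩ := h
    have : E.filter (fun e => pairIn e L) = {e} := by
      ext x
      simp only [Finset.mem_filter, Finset.mem_singleton]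
      exact ⟨fun hx => h2 x hx.1 hx.2, fun hx => hx ▸ ⟨he, h1⟩⟩
    rw [this, Finset.card_singleton, if_pos rfl]
    have hle : (E.filter fun e => revealed E e L).card ≤ 1 :=
      Finset.card_le_one.2 fun x hx y hy => by
        rw [Finset.mem_filter] at hx hy
        exact hy.2.2 x hx.1 hx.2.1
    exact_mod_cast hle
  · rw [Finset.filter_eq_empty_iff.2 fun e he hr => h ⟨e, he, hr⟩]
    split_ifs <;> simp

/-- An edge that no test reveals can be removed. -/
lemma smallerExists_of_not_revealed {n t : ℕ} {E : Finset (Sym2 (Fin n))} (hE : E ⊆ allPairs n)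
    {Ls : Fin t → Finset (Fin n)} {e : Sym2 (Fin n)} (he : e ∈ E)
    (h : ∀ i, ¬ revealed E e (Ls i)) : smallerExists n t E Ls := by
  refine ⟨E.erase e, (Finset.erase_subset _ _).trans hE, fun i => ⟨?_, ?_⟩,
    Finset.card_erase_lt_of_mem he⟩
  · rintro ⟨x, hx, hxL⟩
    exact ⟨x, Finset.mem_of_mem_erase hx, hxL⟩
  · rintro ⟨x, hx, hxL⟩
    by_cases hxe : x = e
    · subst hxe
      have := h i
      simp only [revealed, not_and, not_forall] at this
      obtain ⟨y, hy, hyL, hne⟩ := this hxL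
      exact ⟨y, Finset.mem_erase.2 ⟨hne, hy⟩, hyL⟩
    · exact ⟨x, Finset.mem_erase.2 ⟨hxe, hx⟩, hxL⟩

/-- Power mean bound for the expected number of edges that are never revealed. -/
lemma le_sum_one_sub_pow {ι : Type*} (E : Finset ι) (s : ι → ℝ) (hs : ∀ e ∈ E, s e ≤ 1) (t : ℕ)
    {k ρ : ℝ} (hρ : 0 ≤ ρ) (hρk : ρ < k) (hk : k ≤ E.card) (hsum : ∑ e ∈ E, s e ≤ ρ) :
    k * Real.exp (-(t * (ρ / (k - ρ)))) ≤ ∑ e ∈ E, (1 - s e) ^ t := by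
  have hk0 : 0 < k := hρ.trans_lt hρk
  have hE : (0 : ℝ) < E.card := hk0.trans_le hk
  have hJ := Real.pow_arith_mean_le_arith_mean_pow E (fun _ => (E.card : ℝ)⁻¹) (fun e => 1 - s e)
    (fun _ _ => by positivity) (by simp [hE.ne']) (fun e he => sub_nonneg.2 (hs e he)) t
  rw [← Finset.mul_sum, ← Finset.mul_sum, Finset.sum_sub_distrib] at hJ
  have hbase : Real.exp (-(ρ / (k - ρ))) ≤ (E.card : ℝ)⁻¹ * (∑ _e ∈ E, (1 : ℝ) - ∑ e ∈ E, s e) := by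
    have hkρ : 0 < k - ρ := sub_pos.2 hρk
    have h1 : k / (k - ρ) ≤ Real.exp (ρ / (k - ρ)) := by
      have := Real.add_one_le_exp (ρ / (k - ρ))
      have e : ρ / (k - ρ) + 1 = k / (k - ρ) := by field_simp; ring
      linarith
    have h2 : Real.exp (-(ρ / (k - ρ))) ≤ (k - ρ) / k := by
      rw [Real.exp_neg, ← inv_div k]
      exact inv_anti₀ (by positivity) h1
    refine h2.trans ?_
    rw [Finset.sum_const, nsmul_eq_mul, mul_one, inv_mul_eq_div, div_le_div_iff₀ hk0 hE]
    nlinarith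
  calc k * Real.exp (-(t * (ρ / (k - ρ)))) ≤ E.card * Real.exp (-(ρ / (k - ρ))) ^ t := by
        rw [← Real.exp_nat_mul, mul_neg]
        gcongr
    _ ≤ E.card * ((E.card : ℝ)⁻¹ * ∑ e ∈ E, (1 - s e) ^ t) := by
        refine mul_le_mul_of_nonneg_left (le_trans ?_ hJ) hE.le
        exact pow_le_pow_left₀ (Real.exp_nonneg _) hbase t
    _ = _ := mul_inv_cancel_left₀ hE.ne' _

lemma prob_not_smallerExists_le {n t : ℕ} {p : ℝ} (h0 : 0 ≤ p) (h1 : p ≤ 1)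
    {E : Finset (Sym2 (Fin n))} (hE : E ⊆ allPairs n) {k ρ : ℝ} (hρ : 0 ≤ ρ) (hρk : ρ < k)
    (hk : k ≤ E.card) (hR : singleProb n p E ≤ ρ) :
    (∑ Ls, if ¬ smallerExists n t E Ls then testsWeight n t p Ls else 0) ≤
      1 / (k * Real.exp (-(t * (ρ / (k - ρ))))) := by
  have hw := testWeight_nonneg (n := n) h0 h1
  have hsum : (∑ e ∈ E, ∑ L, testWeight n p L * if revealed E e L then 1 else 0) ≤ ρ := by
    refine le_trans ?_ hR
    rw [Finset.sum_comm]
    refine Finset.sum_le_sum fun L _ => ?_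
    rw [← Finset.mul_sum]
    exact mul_le_mul_of_nonneg_left (sum_revealed_le E L) (hw L)
  have hle1 : ∀ e ∈ E, (∑ L, testWeight n p L * if revealed E e L then 1 else 0) ≤ 1 := by
    intro e _
    refine le_trans ?_ (sum_testWeight n p).le
    refine Finset.sum_le_sum fun L _ => mul_le_of_le_one_right (hw L) ?_
    split_ifs <;> norm_num
  have hμ := le_sum_one_sub_pow E _ hle1 t hρ hρk hk hsum
  have hpos : 0 < k * Real.exp (-(t * (ρ / (k - ρ)))) :=
    mul_pos (hρ.trans_lt hρk) (Real.exp_pos _)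
  refine le_trans ?_ (one_div_le_one_div_of_le hpos hμ)
  refine le_trans ?_ (prob_all_hit_le (testWeight n p) hw (sum_testWeight n p) E t (revealed E)
    (fun L e he e' he' hr hr' => hr'.2 e he hr.1) (hpos.trans_le hμ))
  refine Finset.sum_le_sum fun Ls _ => ?_
  have hW : 0 ≤ testsWeight n t p Ls := Finset.prod_nonneg fun i _ => hw _
  by_cases h : smallerExists n t E Ls
  · rw [if_neg (not_not.2 h)]
    split_ifs
    exacts [hW, le_rfl]
  · rw [if_pos h, if_pos]
    · exact le_rfl
    · intro e he
      by_contra! hc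
      exact h (smallerExists_of_not_revealed hE he hc)

lemma erTestsProb_eq (n t : ℕ) (q p : ℝ)
    (A : Finset (Sym2 (Fin n)) → (Fin t → Finset (Fin n)) → Prop) :
    erTestsProb n t q p A = bexp q (allPairs n)
      (fun E => 1 - ∑ Ls, if ¬ A E Ls then testsWeight n t p Ls else 0) := by
  have h1 : ∑ Ls, testsWeight n t p Ls = 1 := by
    simp only [testsWeight]
    rw [← Fintype.sum_pow (testWeight n p), sum_testWeight, one_pow]
  refine Finset.sum_congr rfl fun E _ => ?_
  beta_reduce
  rw [show (1 : ℝ) - (∑ Ls, if ¬ A E Ls then testsWeight n t p Ls else 0) =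
    ∑ Ls, (testsWeight n t p Ls - if ¬ A E Ls then testsWeight n t p Ls else 0) by
      rw [Finset.sum_sub_distrib, h1], Finset.mul_sum]
  refine Finset.sum_congr rfl fun Ls _ => ?_
  by_cases h : A E Ls <;> simp [h, erWeight]

lemma erTestsProb_le_one {n t : ℕ} {q p : ℝ} (hq0 : 0 ≤ q) (hq1 : q ≤ 1) (h0 : 0 ≤ p) (h1 : p ≤ 1)
    (A : Finset (Sym2 (Fin n)) → (Fin t → Finset (Fin n)) → Prop) :
    erTestsProb n t q p A ≤ 1 := by
  rw [erTestsProb_eq, ← bexp_const (r := q) (S := allPairs n) 1]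
  refine bexp_mono hq0 hq1 fun E _ => ?_
  rw [bexp_const]
  refine sub_le_self _ (Finset.sum_nonneg fun Ls _ => ?_)
  split_ifs
  exacts [le_rfl, Finset.prod_nonneg fun i _ => testWeight_nonneg h0 h1 _]

/-- Explicit lower bound for the probability that a smaller satisfying set exists. -/
lemma le_erTestsProb_smallerExists {n t : ℕ} {q p ε ρ K : ℝ} (hq0 : 0 ≤ q) (hq1 : q < 1)
    (h0 : 0 ≤ p) (h1 : p ≤ 1) (hε : 0 < ε) (hK : K = q * n.choose 2) (hK0 : 0 < K)
    (hρ : Real.exp (-1) / (1 - q) + ε ≤ ρ) (hρK : ρ < (1 - ε) * K) :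
    1 - (1 / ((1 - ε) * K * Real.exp (-(t * (ρ / ((1 - ε) * K - ρ))))) + 1 / (ε ^ 2 * K)
      + K * (p ^ 2) ^ 2 / ε ^ 2) ≤ erTestsProb n t q p (smallerExists n t) := by
  set δ := 1 / ((1 - ε) * K * Real.exp (-(t * (ρ / ((1 - ε) * K - ρ))))) with hδ
  set m := bexp q (allPairs n) (singleProb n p) with hm
  have hρ0 : 0 ≤ ρ := by
    have : 0 < 1 - q := sub_pos.2 hq1
    have : 0 < Real.exp (-1) / (1 - q) + ε := by positivity
    linarith
  have hδ0 : 0 ≤ δ := by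
    have : 0 < (1 - ε) * K := hρ0.trans_lt hρK
    positivity
  have hmρ : m + ε ≤ ρ := by
    have := bexp_singleProb_le (n := n) h0 h1 hq1
    linarith
  have hcard : bexp q (allPairs n) (fun E => (E.card : ℝ)) = K := by
    rw [bexp_card, card_allPairs, hK]
  have hvarcard : bexp q (allPairs n) (fun E => ((E.card : ℝ) - K) ^ 2) ≤ K := by
    have := bexp_sq_sub_le (S := allPairs n) (f := fun E => (E.card : ℝ)) hq0 hq1.le 1
      (fun E a _ ha => by rw [Finset.card_insert_of_notMem ha]; simp)
    rw [hcard, card_allPairs, one_pow, mul_one, mul_comm, ← hK] at this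
    exact this
  have hvarR : bexp q (allPairs n) (fun E => (singleProb n p E - m) ^ 2) ≤ K * (p ^ 2) ^ 2 := by
    have := bexp_sq_sub_le (S := allPairs n) (f := singleProb n p) hq0 hq1.le (p ^ 2)
      (fun E a ha _ => singleProb_insert_sub_le h0 h1 E ha)
    rw [card_allPairs, ← mul_assoc, mul_comm _ q, ← hK] at this
    exact this
  have hpt : ∀ E ⊆ allPairs n, 1 + ((-δ) + ((-(1 / (ε * K) ^ 2)) * ((E.card : ℝ) - K) ^ 2
      + (-(1 / ε ^ 2)) * (singleProb n p E - m) ^ 2)) ≤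
      1 - ∑ Ls, if ¬ smallerExists n t E Ls then testsWeight n t p Ls else 0 := by
    intro E hE
    have hA : 0 ≤ 1 / (ε * K) ^ 2 * ((E.card : ℝ) - K) ^ 2 := by positivity
    have hB : 0 ≤ 1 / ε ^ 2 * (singleProb n p E - m) ^ 2 := by positivity
    have hle : (∑ Ls, if ¬ smallerExists n t E Ls then testsWeight n t p Ls else 0) ≤ 1 := by
      rw [← one_pow t, ← sum_testWeight n p, Fintype.sum_pow]
      refine Finset.sum_le_sum fun Ls _ => ?_
      split_ifs
      exacts [Finset.prod_nonneg fun i _ => testWeight_nonneg h0 h1 _, le_rfl]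
    by_cases hk : (1 - ε) * K ≤ E.card
    · by_cases hR : singleProb n p E ≤ ρ
      · have := prob_not_smallerExists_le (t := t) h0 h1 hE hρ0 hρK hk hR
        linarith
      · have : 1 ≤ 1 / ε ^ 2 * (singleProb n p E - m) ^ 2 := by
          rw [one_div_mul_eq_div, one_le_div (by positivity)]
          exact pow_le_pow_left₀ hε.le (by linarith) 2
        linarith
    · have : 1 ≤ 1 / (ε * K) ^ 2 * ((E.card : ℝ) - K) ^ 2 := by
        rw [one_div_mul_eq_div, one_le_div (by positivity), ← neg_sub K, neg_sq]
        exact pow_le_pow_left₀ (by positivity) (by linarith) 2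
      linarith
  rw [erTestsProb_eq]
  refine le_trans ?_ (bexp_mono hq0 hq1.le hpt)
  rw [bexp_add, bexp_add, bexp_add, bexp_const, bexp_const, bexp_const_mul, bexp_const_mul]
  have e1 : 1 / (ε * K) ^ 2 * bexp q (allPairs n) (fun E => ((E.card : ℝ) - K) ^ 2) ≤
      1 / (ε ^ 2 * K) := by
    calc _ ≤ 1 / (ε * K) ^ 2 * K := by gcongr
      _ = _ := by field_simp
  have e2 : 1 / ε ^ 2 * bexp q (allPairs n) (fun E => (singleProb n p E - m) ^ 2) ≤
      K * (p ^ 2) ^ 2 / ε ^ 2 := by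
    calc _ ≤ 1 / ε ^ 2 * (K * (p ^ 2) ^ 2) := by gcongr
      _ = _ := by ring
  linarith

lemma rpow_le_kbar {θ c₁ : ℝ} (hc₁ : 0 < c₁) {q : ℕ → ℝ} {n : ℕ} (hn : 2 ≤ n)
    (hq : c₁ * (n : ℝ) ^ (2 * (θ - 1)) ≤ q n) : c₁ / 4 * (n : ℝ) ^ (2 * θ) ≤ kbar q n := by
  have hn' : (2 : ℝ) ≤ n := by exact_mod_cast hn
  have h1 : (n : ℝ) ^ (2 * θ) = (n : ℝ) ^ (2 * (θ - 1)) * (n : ℝ) ^ 2 := by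
    rw [← Real.rpow_natCast, ← Real.rpow_add (by linarith)]
    congr 1; push_cast; ring
  rw [kbar, Nat.cast_choose_two, h1]
  calc c₁ / 4 * ((n : ℝ) ^ (2 * (θ - 1)) * (n : ℝ) ^ 2)
      = (c₁ * (n : ℝ) ^ (2 * (θ - 1))) * ((n : ℝ) ^ 2 / 4) := by ring
    _ ≤ q n * (n * (n - 1) / 2) := by
        refine mul_le_mul hq (by nlinarith) (by positivity) (le_trans (by positivity) hq)

lemma sq_testProb_le {ν : ℝ} (hν : 0 < ν) {q : ℕ → ℝ} {n : ℕ} (hK : 0 < kbar q n) :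
    Real.sqrt (2 * ν / (q n * (n : ℝ) ^ 2)) ^ 2 ≤ ν / kbar q n := by
  have hle : 2 * kbar q n ≤ q n * (n : ℝ) ^ 2 := by
    have hq : 0 < q n := pos_of_mul_pos_left hK (by positivity)
    rw [kbar, Nat.cast_choose_two]
    have : (0 : ℝ) ≤ n := by positivity
    nlinarith [mul_nonneg hq.le this]
  rw [Real.sq_sqrt (div_nonneg (by positivity) (by linarith)),
    div_le_div_iff₀ (by linarith) hK]
  nlinarith

lemma tendsto_natCast_rpow_neg {y : ℝ} (hy : 0 < y) :
    Tendsto (fun n : ℕ => (n : ℝ) ^ (-y)) atTop (nhds 0) :=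
  (tendsto_rpow_neg_atTop hy).comp tendsto_natCast_atTop_atTop

/-- The slack `η` absorbs a small multiplicative loss. -/
lemma exists_slack {η : ℝ} (hη : 0 < η) : ∃ ε : ℝ, 0 < ε ∧ ε < 1 / 4 ∧
    (1 - η) * (Real.exp 1 * (Real.exp (-1) + 2 * ε)) ≤ (1 - η / 2) * (1 - 2 * ε) := by
  have hcont : Tendsto (fun ε : ℝ => (1 - η / 2) * (1 - 2 * ε)
      - (1 - η) * (Real.exp 1 * (Real.exp (-1) + 2 * ε))) (nhds 0) (nhds (η / 2)) := by
    have : Continuous (fun ε : ℝ => (1 - η / 2) * (1 - 2 * ε)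
      - (1 - η) * (Real.exp 1 * (Real.exp (-1) + 2 * ε))) := by fun_prop
    convert! this.tendsto 0 using 2
    rw [mul_zero, add_zero, ← Real.exp_add]
    norm_num
    ring
  have h1 := (hcont.eventually (lt_mem_nhds (half_pos hη))).filter_mono
    (nhdsWithin_le_nhds (s := Set.Ioi 0))
  have h2 : ∀ᶠ ε : ℝ in nhdsWithin 0 (Set.Ioi 0), ε < 1 / 4 :=
    (gt_mem_nhds (by norm_num)).filter_mono nhdsWithin_le_nhds
  obtain ⟨ε, ⟨h1, h2⟩, h3⟩ := ((h1.and h2).and self_mem_nhdsWithin).exists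
  exact ⟨ε, h3, h2, by linarith⟩

/-- The expected number of unrevealed edges grows polynomially. -/
lemma rpow_le_mean {θ η ε ρ K c t n : ℝ} (hn : 1 ≤ n) (hθ : 0 < θ) (hε4 : ε < 1 / 4)
    (hslack : (1 - η) * (Real.exp 1 * ρ) ≤ (1 - η / 2) * (1 - 2 * ε)) (hρ : 0 < ρ)
    (hρK : ρ ≤ ε * K) (hK0 : 0 < K) (hK : c * n ^ (2 * θ) ≤ K) (ht0 : 0 ≤ t)
    (ht : t ≤ (1 - η) * (2 * θ * Real.exp 1 * K * Real.log n)) :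
    c / 2 * n ^ (θ * η) ≤ (1 - ε) * K * Real.exp (-(t * (ρ / ((1 - ε) * K - ρ)))) := by
  have hlog : 0 ≤ Real.log n := Real.log_nonneg hn
  have hpos : 0 < (1 - 2 * ε) * K := mul_pos (by linarith) hK0
  have hexp : t * (ρ / ((1 - ε) * K - ρ)) ≤ Real.log n * ((2 - η) * θ) := by
    calc t * (ρ / ((1 - ε) * K - ρ)) ≤ t * (ρ / ((1 - 2 * ε) * K)) := by
          gcongr
          linarith
      _ ≤ (1 - η) * (2 * θ * Real.exp 1 * K * Real.log n) * (ρ / ((1 - 2 * ε) * K)) := by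
          gcongr
      _ = ((1 - η) * (Real.exp 1 * ρ)) * (2 * θ * Real.log n) / (1 - 2 * ε) := by
          have : 1 - 2 * ε ≠ 0 := by linarith
          field_simp
      _ ≤ ((1 - η / 2) * (1 - 2 * ε)) * (2 * θ * Real.log n) / (1 - 2 * ε) := by
          have : 0 < 1 - 2 * ε := by linarith
          gcongr
      _ = Real.log n * ((2 - η) * θ) := by
          have : 1 - 2 * ε ≠ 0 := by linarith
          field_simp
  have hn0 : 0 < n := by linarith
  calc c / 2 * n ^ (θ * η) = 1 / 2 * (c * n ^ (2 * θ)) * n ^ (-((2 - η) * θ)) := by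
        rw [show θ * η = 2 * θ + -((2 - η) * θ) by ring, Real.rpow_add hn0]
        ring
    _ ≤ 1 / 2 * K * n ^ (-((2 - η) * θ)) := by gcongr
    _ ≤ (1 - ε) * K * Real.exp (-(t * (ρ / ((1 - ε) * K - ρ)))) := by
        rw [Real.rpow_def_of_pos hn0]
        have : 1 / 2 ≤ 1 - ε := by linarith
        gcongr
        linarith

/-- SSS lower bound, Theorem 4.
Fix `θ ∈ (0,1)`, `q = Θ(n^{2(θ−1)})` and a constant `ν > 0`; let `G ~ ER(n,q)` with
`k̄ = q·C(n,2)`, and perform `t` i.i.d. Bernoulli(p) tests with `p = √(2ν/(q n²))`.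
If for some `η > 0` one has `t ≤ (1−η)·2θ·e·k̄·ln n` for all `n`, then with probability
tending to `1` there is a satisfying edge set of cardinality strictly smaller than `|E(G)|`
(so any minimum-cardinality satisfying set differs from `E(G)`, and SSS fails). -/
theorem statement3
    (θ : ℝ) (hθ0 : 0 < θ) (hθ1 : θ < 1)
    (ν : ℝ) (hν : 0 < ν)
    (q : ℕ → ℝ) (hq01 : ∀ n, 0 ≤ q n ∧ q n ≤ 1)
    (c₁ c₂ : ℝ) (hc₁ : 0 < c₁)
    (hq : ∀ n : ℕ, c₁ * (n : ℝ) ^ (2 * (θ - 1)) ≤ q n ∧ q n ≤ c₂ * (n : ℝ) ^ (2 * (θ - 1)))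
    (t : ℕ → ℕ) (η : ℝ) (hη : 0 < η)
    (ht : ∀ n : ℕ, (t n : ℝ) ≤ (1 - η) * (2 * θ * Real.exp 1 * kbar q n * Real.log n)) :
    Tendsto (fun n => erTestsProb n (t n) (q n) (Real.sqrt (2 * ν / (q n * (n : ℝ) ^ 2)))
        (fun E Ls => ∃ F : Finset (Sym2 (Fin n)), F ⊆ allPairs n ∧
          (∀ i, covers F (Ls i) ↔ covers E (Ls i)) ∧ F.card < E.card))
      atTop (nhds 1) := by
  obtain ⟨ε, hε, hε4, hslack⟩ := exists_slack hη
  set ρ := Real.exp (-1) + 2 * ε with hρ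
  have hρ0 : 0 < ρ := by positivity
  have hKtop : Tendsto (kbar q) atTop atTop := by
    refine tendsto_atTop_mono' atTop ?_ (((tendsto_rpow_atTop (show 0 < 2 * θ by positivity)).comp
      tendsto_natCast_atTop_atTop).const_mul_atTop (show 0 < c₁ / 4 by positivity))
    filter_upwards [eventually_ge_atTop 2] with n hn
    exact rpow_le_kbar hc₁ hn (hq n).1
  have hq0 : Tendsto q atTop (nhds 0) := by
    have h := (tendsto_natCast_rpow_neg (show 0 < 2 * (1 - θ) by linarith)).const_mul c₂
    rw [mul_zero] at h
    refine squeeze_zero (fun n => (hq01 n).1) (fun n => ?_) h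
    rw [show -(2 * (1 - θ)) = 2 * (θ - 1) by ring]
    exact (hq n).2
  have hexp : Tendsto (fun n => Real.exp (-1) / (1 - q n) + ε) atTop (nhds (Real.exp (-1) + ε)) := by
    have h : Tendsto (fun n => 1 - q n) atTop (nhds 1) := by simpa using hq0.const_sub 1
    simpa using ((tendsto_const_nhds (x := Real.exp (-1))).div h one_ne_zero).add_const ε
  have hlow : Tendsto (fun n : ℕ => 1 - (8 / c₁ * (n : ℝ) ^ (-(θ * η)) + 1 / ε ^ 2 * (kbar q n)⁻¹
      + ν ^ 2 / ε ^ 2 * (kbar q n)⁻¹)) atTop (nhds 1) := by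
    have hinv : Tendsto (fun n => (kbar q n)⁻¹) atTop (nhds 0) := tendsto_inv_atTop_zero.comp hKtop
    have h := ((((tendsto_natCast_rpow_neg (mul_pos hθ0 hη)).const_mul (8 / c₁)).add
      (hinv.const_mul (1 / ε ^ 2))).add (hinv.const_mul (ν ^ 2 / ε ^ 2))).const_sub 1
    simp only [mul_zero, add_zero, sub_zero] at h
    exact h
  have hp1 : ∀ᶠ n in atTop, Real.sqrt (2 * ν / (q n * (n : ℝ) ^ 2)) ≤ 1 := by
    filter_upwards [hKtop.eventually_ge_atTop ν, hKtop.eventually_gt_atTop 0] with n hn hK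
    have := (sq_testProb_le hν hK).trans ((div_le_one hK).2 hn)
    exact (sq_le_one_iff₀ (Real.sqrt_nonneg _)).1 this
  refine tendsto_of_tendsto_of_tendsto_of_le_of_le' hlow tendsto_const_nhds ?_ ?_
  · filter_upwards [hp1, hKtop.eventually_gt_atTop 0, hKtop.eventually_ge_atTop (ρ / ε),
      eventually_ge_atTop 2, hq0.eventually (gt_mem_nhds one_pos),
      hexp.eventually (gt_mem_nhds (show Real.exp (-1) + ε < ρ by linarith))]
      with n hp hK hKρ hn hq1 hexpn
    have hρK : ρ ≤ ε * kbar q n := by rwa [div_le_iff₀' hε] at hKρ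
    have hn1 : (1 : ℝ) ≤ n := by exact_mod_cast (by omega : 1 ≤ n)
    refine le_trans ?_ (le_erTestsProb_smallerExists (t := t n) (hq01 n).1 hq1 (Real.sqrt_nonneg _) hp
      hε (rfl : kbar q n = _) hK hexpn.le (by nlinarith))
    have hmean := rpow_le_mean hn1 hθ0 hε4 hslack hρ0 hρK hK (rpow_le_kbar hc₁ hn (hq n).1)
      (Nat.cast_nonneg (t n)) (ht n)
    have e1 := one_div_le_one_div_of_le (by positivity) hmean
    have e2 : 1 / (c₁ / 4 / 2 * (n : ℝ) ^ (θ * η)) = 8 / c₁ * (n : ℝ) ^ (-(θ * η)) := by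
      rw [Real.rpow_neg (by linarith)]
      field_simp
      norm_num
    have e3 : 1 / (ε ^ 2 * kbar q n) = 1 / ε ^ 2 * (kbar q n)⁻¹ := by field_simp
    have e4 : kbar q n * (Real.sqrt (2 * ν / (q n * (n : ℝ) ^ 2)) ^ 2) ^ 2 / ε ^ 2 ≤
        ν ^ 2 / ε ^ 2 * (kbar q n)⁻¹ := by
      calc _ ≤ kbar q n * (ν / kbar q n) ^ 2 / ε ^ 2 := by
            gcongr
            exact sq_testProb_le hν hK
        _ = _ := by field_simp
    linarith
  · filter_upwards [hp1] with n hp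
    exact erTestsProb_le_one (hq01 n).1 (hq01 n).2 (Real.sqrt_nonneg _) hp _


end
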